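/- For every positive integer p, ∫_0^∞ τ_p(h) dh = 1 − p, where τ_p(h) = (p−1)(2^{−C(p,2)}/Π_{j=0}^{p−1} j!) det_{0≤i,j<p}(A_{i,j}) with A_{i,j} = (−1)^i H_{i+j}(0) − H_{i+j}(h) e^{−h²} for i < p−1 and A_{p−1,j} = (−1)^p H_{p+j}(0) − H_{p+j}(h) e^{−h²}. -/

import Mathlib

open scoped BigOperators
open MeasureTheory

/-- The `k`-th physicists' Hermite polynomial, via
`H_k(z)/k! = Σ_m ((-1)^(k-m)/(k-m)!) (2z)^(2m-k)/(2m-k)!` (terms with negative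
factorial arguments being zero). -/
noncomputable def hermiteH (k : ℕ) (z : ℝ) : ℝ :=
  (k.factorial : ℝ) * ∑ m ∈ Finset.range (k+1),
    if k ≤ 2*m then ((-1:ℝ)^(k-m) / (k-m).factorial) * ((2*z)^(2*m-k) / (2*m-k).factorial)
    else 0

/-- `κ_p(h) = 1 − (2^{-C(p,2)}/Π_{j<p} j!) det_{0≤i,j<p}( (-1)^i H_{i+j}(0) − H_{i+j}(h)e^{-h²} )`. -/
noncomputable def kappa (p : ℕ) (h : ℝ) : ℝ :=
  1 - (((2:ℝ)^(p.choose 2))⁻¹ / ∏ j ∈ Finset.range p, (j.factorial : ℝ)) *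
    Matrix.det (Matrix.of fun i j : Fin p =>
      (-1:ℝ)^(i : ℕ) * hermiteH ((i : ℕ)+(j : ℕ)) 0
        - hermiteH ((i : ℕ)+(j : ℕ)) h * Real.exp (-h^2))

/-- `τ_p(h)`: as `κ_p`, but with the last row of the determinant replaced as in the paper,
and an extra factor `p − 1`. -/
noncomputable def tau (p : ℕ) (h : ℝ) : ℝ :=
  ((p : ℝ) - 1) * (((2:ℝ)^(p.choose 2))⁻¹ / ∏ j ∈ Finset.range p, (j.factorial : ℝ)) *
    Matrix.det (Matrix.of fun i j : Fin p =>
      if (i : ℕ) < p - 1 then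
        (-1:ℝ)^(i : ℕ) * hermiteH ((i : ℕ)+(j : ℕ)) 0
          - hermiteH ((i : ℕ)+(j : ℕ)) h * Real.exp (-h^2)
      else
        (-1:ℝ)^p * hermiteH (p+(j : ℕ)) 0 - hermiteH (p+(j : ℕ)) h * Real.exp (-h^2))

noncomputable def tt (k l : ℕ) (w : ℝ) : ℝ :=
  if 2*l ≤ k then ((-1:ℝ)^l / l.factorial) * (w^(k-2*l) / (k-2*l).factorial) else 0

lemma hermiteH_eq (k N : ℕ) (hN : k < N) (z : ℝ) :
    hermiteH k z = (k.factorial : ℝ) * ∑ l ∈ Finset.range N, tt k l (2*z) := by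
  unfold hermiteH
  congr 1
  rw [← Finset.sum_range_reflect]
  rw [← Finset.sum_subset (Finset.range_subset_range.2 (show k+1 ≤ N from hN))]
  · apply Finset.sum_congr rfl
    intro l hl
    rw [Finset.mem_range] at hl
    unfold tt
    have e1 : k + 1 - 1 - l = k - l := by omega
    have e2 : k - (k - l) = l := by omega
    have e3 : 2 * (k - l) - k = k - 2 * l := by omega
    rw [e1, e2, e3]
    have : k ≤ 2 * (k - l) ↔ 2 * l ≤ k := by omega
    simp only [this]
  · intro l _ hl
    rw [Finset.mem_range] at hl
    unfold tt
    rw [if_neg (by omega)]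

lemma hermiteH_zero (z : ℝ) : hermiteH 0 z = 1 := by simp [hermiteH]
lemma hermiteH_one (z : ℝ) : hermiteH 1 z = 2 * z := by simp [hermiteH, Finset.sum_range_succ]

lemma tt_rec0 (k : ℕ) (w : ℝ) : ((k:ℝ)+2) * tt (k+2) 0 w = w * tt (k+1) 0 w := by
  simp [tt, Nat.factorial_succ]
  have := Nat.factorial_ne_zero k
  field_simp
  ring

lemma tt_rec (k l : ℕ) (w : ℝ) :
    ((k:ℝ)+2) * tt (k+2) (l+1) w = w * tt (k+1) (l+1) w - 2 * tt k l w := by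
  unfold tt
  by_cases h : 2 * l ≤ k
  · rw [if_pos (by omega), if_pos h]
    obtain ⟨m, rfl⟩ := Nat.exists_eq_add_of_le h
    have hl := Nat.factorial_ne_zero l
    have hm := Nat.factorial_ne_zero m
    rcases m with _ | m
    · rw [if_neg (by omega)]
      have e1 : 2 * l + 0 + 2 - 2 * (l+1) = 0 := by omega
      rw [e1]
      simp [Nat.factorial_succ]
      field_simp
      ring
    · rw [if_pos (by omega)]
      have hm := Nat.factorial_ne_zero m
      have e1 : 2 * l + (m+1) + 2 - 2 * (l+1) = m + 1 := by omega
      have e2 : 2 * l + (m+1) + 1 - 2 * (l+1) = m := by omega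
      have e3 : 2 * l + (m+1) - 2 * l = m + 1 := by omega
      rw [e1, e2, e3]
      push_cast [Nat.factorial_succ]
      field_simp
      ring
  · rw [if_neg (by omega), if_neg (by omega), if_neg h]; simp

lemma hermiteH_rec (k : ℕ) (z : ℝ) :
    hermiteH (k+2) z = 2 * z * hermiteH (k+1) z - 2 * ((k:ℝ)+1) * hermiteH k z := by
  rw [hermiteH_eq (k+2) (k+3+1) (by omega), hermiteH_eq (k+1) (k+3+1) (by omega),
    hermiteH_eq k (k+3) (by omega)]
  have h : ((k:ℝ)+2) * ∑ l ∈ Finset.range (k+3+1), tt (k+2) l (2*z)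
      = 2*z * ∑ l ∈ Finset.range (k+3+1), tt (k+1) l (2*z)
        - 2 * ∑ l ∈ Finset.range (k+3), tt k l (2*z) := by
    rw [Finset.sum_range_succ', Finset.sum_range_succ' (fun l => tt (k+1) l (2*z)), mul_add,
      tt_rec0, Finset.mul_sum]
    simp only [tt_rec]
    rw [Finset.sum_sub_distrib, ← Finset.mul_sum, ← Finset.mul_sum]
    ring
  push_cast [Nat.factorial_succ]
  linear_combination ((k:ℝ)+1) * (k.factorial : ℝ) * h

lemma hermiteH_deriv (k : ℕ) (z : ℝ) :
    HasDerivAt (hermiteH k) (2 * (k:ℝ) * hermiteH (k-1) z) z ∧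
    HasDerivAt (hermiteH (k+1)) (2 * ((k:ℝ)+1) * hermiteH k z) z := by
  induction k with
  | zero =>
    constructor
    · have : hermiteH 0 = fun _ => 1 := funext hermiteH_zero
      rw [this]; simpa using hasDerivAt_const z (1:ℝ)
    · have : hermiteH (0+1) = fun z => 2 * z := funext hermiteH_one
      rw [this]; simpa [hermiteH_zero] using (hasDerivAt_id z).const_mul 2
  | succ k ih =>
    refine ⟨by simpa using ih.2, ?_⟩
    have : hermiteH (k+1+1) = fun z => 2 * z * hermiteH (k+1) z - 2 * ((k:ℝ)+1) * hermiteH k z :=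
      funext (hermiteH_rec k)
    rw [this]
    have h := (((hasDerivAt_id z).const_mul 2).mul ih.2).sub (ih.1.const_mul (2 * ((k:ℝ)+1)))
    refine HasDerivAt.congr_deriv h ?_
    rcases k with _ | k
    · simp [hermiteH_zero, hermiteH_one]; ring
    · have h5 := hermiteH_rec k z
      simp only [Nat.add_sub_cancel, id]
      push_cast
      linear_combination (-(2 * ((k:ℝ)+2))) * h5

noncomputable def gg (k : ℕ) (h : ℝ) : ℝ := hermiteH k h * Real.exp (-h^2)

lemma gg_deriv (k : ℕ) (z : ℝ) : HasDerivAt (gg k) (- gg (k+1) z) z := by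
  have h1 : HasDerivAt (fun h : ℝ => Real.exp (-h^2)) (Real.exp (-z^2) * (-(2 * z))) z := by
    have := ((hasDerivAt_id z).pow 2).neg.exp
    simpa using this
  have h := (hermiteH_deriv k z).1.mul h1
  refine HasDerivAt.congr_deriv h ?_
  unfold gg
  rcases k with _ | k
  · simp [hermiteH_zero, hermiteH_one]; ring
  · have h5 := hermiteH_rec (k+1) z
    have h6 := hermiteH_rec k z
    simp only [Nat.add_sub_cancel]
    push_cast at *
    rw [show k+1+1 = k+2 from rfl]
    linear_combination (Real.exp (-z^2)) * h6

lemma gg_cont (k : ℕ) : Continuous (gg k) :=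
  continuous_iff_continuousAt.2 fun z => (gg_deriv k z).continuousAt

lemma poly_bigO (k : ℕ) : ∃ n : ℕ, (hermiteH k) =O[Filter.atTop] (fun z : ℝ => z^n) ∧
    (hermiteH (k+1)) =O[Filter.atTop] (fun z : ℝ => z^n) := by
  have mono : ∀ n m : ℕ, n ≤ m → (fun z : ℝ => z^n) =O[Filter.atTop] (fun z : ℝ => z^m) := by
    intro n m h
    apply Asymptotics.IsBigO.of_bound 1
    filter_upwards [Filter.eventually_ge_atTop (1:ℝ)] with z hz
    rw [Real.norm_of_nonneg (by positivity), Real.norm_of_nonneg (by positivity), one_mul]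
    exact pow_le_pow_right₀ hz h
  have hid : ∀ n, (fun z : ℝ => 2 * z * z^n) =O[Filter.atTop] (fun z : ℝ => z^(n+1)) := by
    intro n
    have := (Asymptotics.isBigO_refl (fun z : ℝ => z^(n+1)) Filter.atTop).const_mul_left 2
    refine this.congr_left fun z => by ring
  induction k with
  | zero =>
    refine ⟨1, ?_, ?_⟩
    · have : hermiteH 0 = fun z => z^0 := by funext z; simp [hermiteH_zero]
      rw [this]; exact mono 0 1 (by omega)
    · have : hermiteH (0+1) = fun z => 2 * z * z^0 := by funext z; simp [hermiteH_one]
      rw [this]; exact hid 0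
  | succ k ih =>
    obtain ⟨n, h0, h1⟩ := ih
    refine ⟨n+1, h1.trans (mono _ _ (by omega)), ?_⟩
    have : hermiteH (k+1+1) = fun z => 2 * z * hermiteH (k+1) z - 2 * ((k:ℝ)+1) * hermiteH k z :=
      funext (hermiteH_rec k)
    rw [this]
    refine Asymptotics.IsBigO.sub ?_ ((h0.const_mul_left _).trans (mono _ _ (by omega)))
    exact ((Asymptotics.isBigO_refl (fun z : ℝ => 2 * z) _).mul h1).trans (hid n)

lemma gg_bigO (k : ℕ) : (gg k) =O[Filter.atTop] (fun z : ℝ => Real.exp (-1 * z)) := by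
  obtain ⟨n, h, -⟩ := poly_bigO k
  have h2 := h.mul (Asymptotics.isBigO_refl (fun z : ℝ => Real.exp (-z^2)) _)
  refine h2.trans ?_
  have h3 : (fun z : ℝ => z^n * Real.exp (-z)) =O[Filter.atTop] (fun _ : ℝ => (1:ℝ)) :=
    (Real.tendsto_pow_mul_exp_neg_atTop_nhds_zero n).isBigO_one ℝ
  have h4 := h3.mul (Asymptotics.isBigO_refl (fun z : ℝ => Real.exp (-1*z)) Filter.atTop)
  refine Asymptotics.IsBigO.trans ?_ (h4.congr_right fun z => one_mul _)
  apply Asymptotics.IsBigO.of_bound 1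
  filter_upwards [Filter.eventually_ge_atTop (2:ℝ)] with z hz
  rw [Real.norm_of_nonneg (by positivity), Real.norm_of_nonneg (by positivity), one_mul, mul_assoc,
    ← Real.exp_add]
  gcongr
  nlinarith

lemma gg_tendsto (k : ℕ) : Filter.Tendsto (gg k) Filter.atTop (nhds 0) := by
  refine (gg_bigO k).trans_tendsto ?_
  simpa using Real.tendsto_exp_neg_atTop_nhds_zero

lemma hermiteH_zero_odd (k : ℕ) : hermiteH (2*k+1) 0 = 0 := by
  induction k with
  | zero => simp [hermiteH_one]
  | succ k ih =>
    have := hermiteH_rec (2*k+1) 0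
    rw [ih] at this
    rw [show 2*(k+1)+1 = 2*k+1+2 by ring, this]; simp

noncomputable def aa (i j : ℕ) : ℝ := (-1:ℝ)^i * hermiteH (i+j) 0

lemma aa_symm (i j : ℕ) : aa i j = aa j i := by
  unfold aa
  rw [add_comm j i]
  rcases Nat.even_or_odd' (i+j) with ⟨k, h | h⟩
  · have : (-1:ℝ)^i = (-1)^j := by
      rw [neg_one_pow_eq_pow_mod_two, neg_one_pow_eq_pow_mod_two (n := j)]
      congr 1; omega
    rw [this]
  · rw [h, hermiteH_zero_odd]; simp

lemma aa_anti (i j : ℕ) : aa (i+1) j = - aa (j+1) i := by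
  unfold aa
  have e : j + 1 + i = i + 1 + j := by omega
  rw [e]
  rcases Nat.even_or_odd' (i+1+j) with ⟨k, h | h⟩
  · have : (-1:ℝ)^(i+1) = -(-1)^(j+1) := by
      have h2 : (-1:ℝ)^(i+1) = (-1)^j := by
        rw [neg_one_pow_eq_pow_mod_two, neg_one_pow_eq_pow_mod_two (n := j)]
        congr 1; omega
      rw [h2, pow_succ]; ring
    rw [this]; ring
  · rw [h, hermiteH_zero_odd]; simp

noncomputable def LL (i k : ℕ) : ℝ := (i.choose k : ℝ) * hermiteH (i-k) 0

lemma LL_zero_of_lt {i k : ℕ} (h : i < k) : LL i k = 0 := by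
  simp [LL, Nat.choose_eq_zero_of_lt h]

lemma LL_aux (i k : ℕ) : (i.choose k : ℝ) * hermiteH (i+1-k) 0 = -2 * ((k:ℝ)+1) * LL i (k+1) := by
  unfold LL
  rcases lt_trichotomy i k with h | h | h
  · simp [Nat.choose_eq_zero_of_lt h, Nat.choose_eq_zero_of_lt (show i < k+1 by omega)]
  · subst h
    simp [hermiteH_one]
  · obtain ⟨m, rfl⟩ := Nat.exists_eq_add_of_lt h
    have e1 : k + m + 1 + 1 - k = m + 2 := by omega
    have e2 : k + m + 1 - (k+1) = m := by omega
    rw [e1, e2, hermiteH_rec]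
    have h1 := Nat.choose_succ_right_eq (k+m+1) k
    have e3 : k + m + 1 - k = m + 1 := by omega
    rw [e3] at h1
    have h2 : (((k+m+1).choose (k+1) : ℕ):ℝ) * ((k:ℝ)+1) = ((k+m+1).choose k : ℝ) * ((m:ℝ)+1) := by
      exact_mod_cast h1
    linear_combination 2 * hermiteH m 0 * h2

lemma LL_succ_zero (i : ℕ) : LL (i+1) 0 = -2 * LL i 1 := by
  have := LL_aux i 0
  simp at this
  simpa [LL] using this

lemma LL_succ_succ (i k : ℕ) : LL (i+1) (k+1) = LL i k - 2 * ((k:ℝ)+2) * LL i (k+2) := by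
  have h := LL_aux i (k+1)
  have e : i + 1 - (k+1) = i - k := by omega
  rw [e] at h
  push_cast at h
  unfold LL at *
  rw [Nat.choose_succ_succ, e]
  push_cast
  linear_combination h

noncomputable def dd (k : ℕ) : ℝ := (-2)^k * (k.factorial : ℝ)

noncomputable def SS (N m n : ℕ) : ℝ := ∑ k ∈ Finset.range N, LL m k * dd k * LL n k

lemma SS_step_aux (N m n : ℕ) (hm : m < N) (hn : n < N) : SS (N+1) (m+1) n =
    ∑ k ∈ Finset.range N, dd (k+1) * (LL m k * LL n (k+1) + LL m (k+1) * LL n k) := by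
  unfold SS
  rw [Finset.sum_range_succ']
  have h1 : ∀ k, LL (m+1) (k+1) * dd (k+1) * LL n (k+1) =
      dd (k+1) * (LL m k * LL n (k+1)) + dd (k+2) * (LL m (k+2) * LL n (k+1)) := by
    intro k
    rw [LL_succ_succ]
    unfold dd
    push_cast [Nat.factorial_succ]
    ring
  simp only [h1]
  rw [Finset.sum_add_distrib]
  simp only [mul_add]
  rw [Finset.sum_add_distrib, add_assoc]
  congr 1
  rw [LL_succ_zero]
  have h2 : -2 * LL m 1 * dd 0 * LL n 0 = dd (0+1) * (LL m (0+1) * LL n 0) := by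
    simp [dd]; ring
  rw [h2, ← Finset.sum_range_succ' (fun k => dd (k+1) * (LL m (k+1) * LL n k)), Finset.sum_range_succ]
  rw [LL_zero_of_lt hn]; simp

lemma SS_step (N m n : ℕ) (hm : m < N) (hn : n < N) : SS (N+1) (m+1) n = SS (N+1) m (n+1) := by
  have : SS (N+1) m (n+1) = SS (N+1) (n+1) m := by
    unfold SS; exact Finset.sum_congr rfl fun k _ => by ring
  rw [this, SS_step_aux N m n hm hn, SS_step_aux N n m hn hm]
  exact Finset.sum_congr rfl fun k _ => by ring

lemma SS_zero (N n : ℕ) : SS (N+1) 0 n = hermiteH n 0 := by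
  unfold SS
  rw [Finset.sum_range_succ', Finset.sum_eq_zero]
  · simp [LL, dd, hermiteH_zero]
  · intro k _; rw [LL_zero_of_lt (Nat.succ_pos k)]; simp

lemma SS_eq (N m n : ℕ) (h : m + n < N) : SS (N+1) m n = hermiteH (m+n) 0 := by
  induction m generalizing n with
  | zero => rw [SS_zero, zero_add]
  | succ m ih =>
    rw [SS_step N m n (by omega) (by omega), ih (n+1) (by omega)]
    congr 1; omega

lemma SS_fin (p : ℕ) (m n : Fin p) : ∑ k : Fin p, LL m k * dd k * LL n k = hermiteH ((m:ℕ)+n) 0 := by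
  rw [← SS_eq (2*p) m n (by omega)]
  unfold SS
  rw [Fin.sum_univ_eq_sum_range (fun k => LL m k * dd k * LL n k) p]
  apply Finset.sum_subset (Finset.range_subset_range.2 (by omega))
  intro k _ hk
  rw [Finset.mem_range] at hk
  rw [LL_zero_of_lt (show (m:ℕ) < k by omega)]; simp

lemma det_aa (p : ℕ) : Matrix.det (Matrix.of fun i j : Fin p => aa i j)
    = (2:ℝ)^(p.choose 2) * ∏ j ∈ Finset.range p, (j.factorial : ℝ) := by
  have hM : (Matrix.of fun i j : Fin p => aa i j) =
      Matrix.diagonal (fun i : Fin p => (-1:ℝ)^(i:ℕ)) * ((Matrix.of fun i j : Fin p => LL i j) *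
        Matrix.diagonal (fun i : Fin p => dd i) * (Matrix.of fun i j : Fin p => LL i j).transpose) := by
    ext i j
    rw [Matrix.diagonal_mul, Matrix.mul_apply]
    simp only [Matrix.mul_diagonal, Matrix.transpose_apply, Matrix.of_apply]
    rw [SS_fin]; rfl
  have hL : Matrix.det (Matrix.of fun i j : Fin p => LL i j) = 1 := by
    rw [Matrix.det_of_isLowerTriangular]
    · simp [LL, hermiteH_zero]
    · intro i j hij
      exact LL_zero_of_lt (by simpa using hij)
  rw [hM, Matrix.det_mul, Matrix.det_mul, Matrix.det_mul, Matrix.det_transpose, hL,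
    Matrix.det_diagonal, Matrix.det_diagonal, one_mul, mul_one, ← Finset.prod_mul_distrib,
    Fin.prod_univ_eq_prod_range (fun k => (-1:ℝ)^k * dd k) p]
  have : ∀ k, (-1:ℝ)^k * dd k = 2^k * (k.factorial:ℝ) := by
    intro k; unfold dd; rw [← mul_assoc, ← mul_pow]; norm_num
  simp only [this]
  rw [Finset.prod_mul_distrib, Finset.prod_pow_eq_pow_sum, Finset.sum_range_id, Nat.choose_two_right]

noncomputable def MM (p : ℕ) (h : ℝ) : Matrix (Fin p) (Fin p) ℝ :=
  Matrix.of fun i j => aa i j - gg ((i:ℕ)+j) h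

lemma MM_symm (p : ℕ) (h : ℝ) : (MM p h).transpose = MM p h := by
  ext i j
  simp [MM, aa_symm j i, add_comm (j:ℕ) i]

lemma det_upd {p : ℕ} (M : Matrix (Fin p) (Fin p) ℝ) (hM : M.transpose = M) (i : Fin p)
    (b : Fin p → ℝ) : (M.updateRow i b).det = ∑ j, M.adjugate i j * b j := by
  rw [← Matrix.cramer_transpose_apply, hM, Matrix.cramer_eq_adjugate_mulVec]
  rfl

lemma sum_aa (p : ℕ) (M : Matrix (Fin p) (Fin p) ℝ) (hM : M.transpose = M) :
    ∑ i : Fin p, (M.updateRow i (fun j => aa ((i:ℕ)+1) j)).det = 0 := by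
  simp only [det_upd M hM]
  have hs : ∀ i j, M.adjugate i j = M.adjugate j i := by
    intro i j
    have h3 := Matrix.adjugate_transpose M
    rw [hM] at h3
    exact congrFun (congrFun h3 j) i
  have : ∑ i : Fin p, ∑ j : Fin p, M.adjugate i j * aa ((i:ℕ)+1) j
      = - ∑ i : Fin p, ∑ j : Fin p, M.adjugate i j * aa ((i:ℕ)+1) j := by
    conv_lhs => rw [Finset.sum_comm]
    rw [← Finset.sum_neg_distrib]
    refine Finset.sum_congr rfl fun i _ => ?_
    rw [← Finset.sum_neg_distrib]
    refine Finset.sum_congr rfl fun j _ => ?_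
    rw [hs j i, aa_anti]; ring
  linarith

/-- Derivative of a determinant, row by row. -/
lemma det_hasDerivAt {p : ℕ} (M : ℝ → Matrix (Fin p) (Fin p) ℝ) (B : Matrix (Fin p) (Fin p) ℝ)
    (z : ℝ) (h : ∀ i j, HasDerivAt (fun x => M x i j) (B i j) z) :
    HasDerivAt (fun x => (M x).det) (∑ i, ((M z).updateRow i (B i)).det) z := by
  have h1 : ∀ σ : Equiv.Perm (Fin p), HasDerivAt (fun x => ∏ i, (M x).transpose (σ i) i)
      (∑ i, ∏ j, ((M z).updateRow i (B i)).transpose (σ j) j) z := by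
    intro σ
    have := HasDerivAt.fun_finsetProd (u := Finset.univ) (fun i _ => h i (σ i))
    refine HasDerivAt.congr_deriv this ?_
    refine Finset.sum_congr rfl fun i _ => ?_
    rw [← Finset.mul_prod_erase _ _ (Finset.mem_univ i)]
    simp only [Matrix.transpose_apply, Matrix.updateRow_self, smul_eq_mul]
    rw [mul_comm]
    congr 1
    refine Finset.prod_congr rfl fun j hj => ?_
    rw [Matrix.updateRow_ne (Finset.ne_of_mem_erase hj)]
  have h2 := HasDerivAt.fun_sum (u := Finset.univ)
    (fun σ _ => (h1 σ).const_mul (((Equiv.Perm.sign σ : ℤ) : ℝ)))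
  have e : ∀ A : Matrix (Fin p) (Fin p) ℝ, A.det =
      ∑ σ : Equiv.Perm (Fin p), ((Equiv.Perm.sign σ : ℤ) : ℝ) * ∏ i, A.transpose (σ i) i := by
    intro A
    rw [← Matrix.det_transpose, Matrix.det_apply']
  simp only [e]
  refine HasDerivAt.congr_deriv h2 ?_
  rw [Finset.sum_comm]
  simp only [Finset.mul_sum]

noncomputable def TT (p : ℕ) (h : ℝ) : ℝ := ∑ i : Fin p, ((MM p h).updateRow i (fun j => gg ((i:ℕ)+j+1) h)).det

lemma det_deriv (p : ℕ) (z : ℝ) : HasDerivAt (fun h => (MM p h).det) (TT p z) z := by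
  refine det_hasDerivAt (MM p) (fun i j => gg ((i:ℕ)+j+1) z) z ?_
  intro i j
  have := (gg_deriv ((i:ℕ)+j) z).const_sub (aa i j)
  simpa [MM] using this

lemma TT_integrable (p : ℕ) : IntegrableOn (TT p) (Set.Ioi 0) := by
  have hc : Continuous (MM p) := by
    refine continuous_matrix fun i j => ?_
    exact continuous_const.sub (gg_cont _)
  have ht : Filter.Tendsto (MM p) Filter.atTop (nhds (Matrix.of fun i j : Fin p => aa i j)) := by
    refine tendsto_pi_nhds.2 fun i => tendsto_pi_nhds.2 fun j => ?_
    simpa [MM] using (gg_tendsto ((i:ℕ)+j)).const_sub (aa i j)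
  have hadj : Continuous (fun A : Matrix (Fin p) (Fin p) ℝ => A.adjugate) :=
    Continuous.matrix_adjugate continuous_id
  have hT : TT p = fun h => ∑ i : Fin p, ∑ j : Fin p, (MM p h).adjugate i j * gg ((i:ℕ)+j+1) h := by
    funext h
    unfold TT
    simp only [det_upd _ (MM_symm p h)]
  rw [hT]
  refine integrable_finsetSum _ fun i _ => integrable_finsetSum _ fun j _ => ?_
  refine integrable_of_isBigO_exp_neg (b := 1) one_pos ?_ ?_
  · exact (((hadj.comp hc).matrix_elem i j).mul (gg_cont _)).continuousOn
  · have h1 : Filter.Tendsto (fun h => (MM p h).adjugate i j) Filter.atTop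
        (nhds ((Matrix.of fun i j : Fin p => aa i j).adjugate i j)) :=
      ((hadj.matrix_elem i j).tendsto _).comp ht
    have h2 := (h1.isBigO_one ℝ).mul (gg_bigO ((i:ℕ)+j+1))
    exact h2.congr_right fun z => one_mul _

lemma TT_integral (p : ℕ) (hp : 0 < p) : ∫ h in Set.Ioi (0:ℝ), TT p h =
    (2:ℝ)^(p.choose 2) * ∏ j ∈ Finset.range p, (j.factorial : ℝ) := by
  have ht : Filter.Tendsto (MM p) Filter.atTop (nhds (Matrix.of fun i j : Fin p => aa i j)) := by
    refine tendsto_pi_nhds.2 fun i => tendsto_pi_nhds.2 fun j => ?_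
    simpa [MM] using (gg_tendsto ((i:ℕ)+j)).const_sub (aa i j)
  have hdet : Continuous (fun A : Matrix (Fin p) (Fin p) ℝ => A.det) :=
    Continuous.matrix_det continuous_id
  rw [integral_Ioi_of_hasDerivAt_of_tendsto' (fun z _ => det_deriv p z) (TT_integrable p)
    ((hdet.tendsto _).comp ht), det_aa, Matrix.det_eq_zero_of_row_eq_zero (⟨0, hp⟩ : Fin p), sub_zero]
  intro j
  simp [MM, aa, gg]

lemma tau_eq (p : ℕ) (hp : 0 < p) (h : ℝ) : tau p h =
    ((p : ℝ) - 1) * (((2:ℝ)^(p.choose 2))⁻¹ / ∏ j ∈ Finset.range p, (j.factorial : ℝ)) * (- TT p h) := by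
  unfold tau
  congr 1
  obtain ⟨q, rfl⟩ := Nat.exists_eq_succ_of_ne_zero hp.ne'
  have hrow : ∀ i : Fin (q+1), (fun j : Fin (q+1) => gg ((i:ℕ)+j+1) h) =
      (fun j : Fin (q+1) => aa ((i:ℕ)+1) j) + (-1:ℝ) • (fun j : Fin (q+1) => aa ((i:ℕ)+1) j - gg ((i:ℕ)+1+j) h) := by
    intro i; funext j
    have : (i:ℕ)+j+1 = i+1+j := by omega
    simp [this]
  unfold TT
  simp only [hrow, Matrix.det_updateRow_add, Matrix.det_updateRow_smul]
  rw [Finset.sum_add_distrib, sum_aa _ _ (MM_symm _ h), zero_add, ← Finset.mul_sum, neg_one_mul, neg_neg,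
    Fin.sum_univ_castSucc, Finset.sum_eq_zero, zero_add]
  · congr 1
    ext i j
    by_cases hi : i = Fin.last q
    · subst hi
      simp [aa, gg]
    · rw [Matrix.updateRow_ne hi]
      have : (i:ℕ) < q := Fin.val_lt_last hi
      simp [this, MM, aa, gg]
  · intro i _
    refine Matrix.det_zero_of_row_eq (i := i.castSucc) (j := i.succ) ?_ ?_
    · exact (Fin.castSucc_lt_succ).ne
    · rw [Matrix.updateRow_self, Matrix.updateRow_ne (Fin.castSucc_lt_succ).ne']
      funext j
      simp [MM]

/-- `∫_0^∞ τ_p(h) dh = 1 − p`. -/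
theorem stmt14 (p : ℕ) (hp : 0 < p) :
    ∫ h in Set.Ioi (0:ℝ), tau p h = 1 - (p : ℝ) := by
  simp only [tau_eq p hp]
  rw [integral_const_mul, integral_neg, TT_integral p hp]
  have h1 : (2:ℝ)^(p.choose 2) ≠ 0 := by positivity
  have h2 : ∏ j ∈ Finset.range p, (j.factorial : ℝ) ≠ 0 :=
    Finset.prod_ne_zero_iff.2 fun j _ => by positivity
  field_simp
  ring
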